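/- Let k ≥ 3 and 1 ≤ n₁ ≤ ⋯ ≤ n_k. The 6-secant variety of the Segre variety P^{n₁} × ⋯ × P^{n_k} is non-defective, i.e. T(n₁,…,n_k; 6; 0,…,0) holds, unless (n₁,…,n_k) = (1,3,a) with a ≥ 6, (n₁,…,n_k) = (1,4,a) with a ≥ 6, (n₁,…,n_k) = (2,2,a) with a ≥ 6, or (n₁,…,n_k) = (1,1,1,a) with a ≥ 6; in these exceptional cases T(n₁,…,n_k; 6; 0,…,0) fails. -/

import Mathlib

open scoped TensorProduct

/-- The subspace `G^i_p = v₁ ⊗ ⋯ ⊗ v_{i-1} ⊗ Vᵢ ⊗ v_{i+1} ⊗ ⋯ ⊗ v_k` of the tensor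
space `⨂ᵢ K^{nᵢ+1}` attached to the point `p = v₁ ⊗ ⋯ ⊗ v_k`. -/
noncomputable def segreG (K : Type*) [Field K] {k : ℕ} (n : Fin k → ℕ)
    (v : ∀ i, Fin (n i + 1) → K) (i : Fin k) :
    Submodule K (⨂[K] i, (Fin (n i + 1) → K)) :=
  LinearMap.range ((PiTensorProduct.tprod K).toLinearMap v i)

/-- The affine tangent space `T_p = Σᵢ v₁ ⊗ ⋯ ⊗ Vᵢ ⊗ ⋯ ⊗ v_k` to the Segre variety at
`p = v₁ ⊗ ⋯ ⊗ v_k`. -/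
noncomputable def segreTangent (K : Type*) [Field K] {k : ℕ} (n : Fin k → ℕ)
    (v : ∀ i, Fin (n i + 1) → K) : Submodule K (⨂[K] i, (Fin (n i + 1) → K)) :=
  ⨆ i, segreG K n v i

/-- The statement `T(n₁,…,n_k; s; a₁,…,a_k)` of Abo–Ottaviani–Peterson holds:
there are points `p₁,…,p_s` and `q_{i,1},…,q_{i,aᵢ}` (pure tensors of nonzero vectors)
such that the span of the tangent spaces `T_{p_j}` together with the subspaces
`G^i_{q_{i,l}}` has the expected (maximal possible) dimension
`min (s(1 + Σ nᵢ) + Σ aᵢ(nᵢ+1)) (Π (nᵢ+1))`. -/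
def THolds (K : Type*) [Field K] {k : ℕ} (n : Fin k → ℕ) (s : ℕ) (a : Fin k → ℕ) : Prop :=
  ∃ (p : Fin s → ∀ i, Fin (n i + 1) → K)
    (q : ∀ i : Fin k, Fin (a i) → ∀ j, Fin (n j + 1) → K),
    (∀ j i, p j i ≠ 0) ∧ (∀ i l j, q i l j ≠ 0) ∧
    Module.finrank K
      (((⨆ j, segreTangent K n (p j)) ⊔ (⨆ i, ⨆ l, segreG K n (q i l) i))
        : Submodule K (⨂[K] i, (Fin (n i + 1) → K)))
      = min (s * (1 + ∑ i, n i) + ∑ i, a i * (n i + 1)) (∏ i, (n i + 1))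

/-- The statement `T(n₁,…,n_k; s; a₁,…,a_k)` fails: every choice of points gives a span
of dimension strictly smaller than the expected dimension. -/
def TFails (K : Type*) [Field K] {k : ℕ} (n : Fin k → ℕ) (s : ℕ) (a : Fin k → ℕ) : Prop :=
  ∀ (p : Fin s → ∀ i, Fin (n i + 1) → K)
    (q : ∀ i : Fin k, Fin (a i) → ∀ j, Fin (n j + 1) → K),
    (∀ j i, p j i ≠ 0) → (∀ i l j, q i l j ≠ 0) →
    Module.finrank K
      (((⨆ j, segreTangent K n (p j)) ⊔ (⨆ i, ⨆ l, segreG K n (q i l) i))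
        : Submodule K (⨂[K] i, (Fin (n i + 1) → K)))
      < min (s * (1 + ∑ i, n i) + ∑ i, a i * (n i + 1)) (∏ i, (n i + 1))

/-- The tuple `(n; s; a)` is subabundant. -/
def Subabundant {k : ℕ} (n : Fin k → ℕ) (s : ℕ) (a : Fin k → ℕ) : Prop :=
  s * (1 + ∑ i, n i) + ∑ i, a i * (n i + 1) ≤ ∏ i, (n i + 1)

/-- The tuple `(n; s; a)` is superabundant. -/
def Superabundant {k : ℕ} (n : Fin k → ℕ) (s : ℕ) (a : Fin k → ℕ) : Prop :=
  ∏ i, (n i + 1) ≤ s * (1 + ∑ i, n i) + ∑ i, a i * (n i + 1)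

/-- Splits off the first entry of a list satisfying `q`. -/
def extractPivot (q : ℕ → Bool) : List ℕ → Option (ℕ × List ℕ)
  | [] => none
  | a :: l => if q a then some (a, l) else (extractPivot q l).map fun x => (x.1, a :: x.2)

theorem extractPivot_spec {q : ℕ → Bool} {l : List ℕ} {x : ℕ × List ℕ}
    (h : extractPivot q l = some x) : x.1 ∈ l ∧ q x.1 = true ∧ ∀ y ∈ x.2, y ∈ l := by
  induction l generalizing x with
  | nil => simp [extractPivot] at h
  | cons a l ih =>
    rw [extractPivot] at h
    split_ifs at h with hq
    · obtain rfl := Option.some.inj h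
      exact ⟨by simp, hq, fun y hy => by simp [hy]⟩
    · obtain ⟨z, hz, rfl⟩ := Option.map_eq_some_iff.mp h
      obtain ⟨h1, h2, h3⟩ := ih hz
      refine ⟨by simp [h1], h2, fun y hy => ?_⟩
      rcases List.mem_cons.mp hy with rfl | hy
      · simp
      · simp [h3 y hy]

/-- Evaluates its first argument before passing it on: `f` receives a numeral when `force` is
unfolded by weak head reduction. -/
def force {α : Type*} (a : ℕ) (f : ℕ → α) : α := Nat.rec (f 0) (fun m _ => f (m + 1)) a

theorem force_eq {α : Type*} (a : ℕ) (f : ℕ → α) : force a f = f a := by cases a <;> rfl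

/-- `List.map` with evaluation of the entries. -/
def mapForce (f : ℕ → ℕ) : List ℕ → List ℕ
  | [] => []
  | a :: l => force (f a) fun b => b :: mapForce f l

theorem mapForce_eq (f : ℕ → ℕ) (l : List ℕ) : mapForce f l = l.map f := by
  induction l with
  | nil => rfl
  | cons a l ih => rw [mapForce, force_eq, ih, List.map_cons]

/-- Gaussian elimination modulo `p` on rows with `c` entries, each row being given by the natural
number whose base `B` digits are its entries (the entries are not reduced modulo `p`).  The
result is the number of pivots. -/
def packedRank (p B : ℕ) : ℕ → List ℕ → ℕ
  | 0, _ => 0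
  | c + 1, rows =>
    match extractPivot (fun s => !(s % B % p == 0)) rows with
    | none => packedRank p B c (mapForce (fun s => s / B) rows)
    | some (r, rest) =>
      force (r % B % p) fun u =>
        packedRank p B c (mapForce (fun s => (u * s + (p - s % B % p) * r) / B) rest) + 1

/-- The linear map which forgets the first entry of a vector. -/
def dropHead (F : Type*) [Field F] (c : ℕ) : (Fin (c + 1) → F) →ₗ[F] (Fin c → F) :=
  LinearMap.funLeft F F Fin.succ

theorem packed_head {B c : ℕ} {d : ℕ → ℕ} (h : d 0 < B) :
    (∑ x ∈ Finset.range (c + 1), d x * B ^ x) % B = d 0 := by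
  rw [Finset.sum_range_succ', pow_zero, mul_one, Nat.add_mod, Finset.sum_nat_mod]
  have : ∀ x ∈ Finset.range c, d (x + 1) * B ^ (x + 1) % B = 0 := fun x _ => by
    rw [pow_succ, ← mul_assoc, Nat.mul_mod_left]
  rw [Finset.sum_congr rfl this]
  simp [Nat.mod_eq_of_lt h]

theorem packed_tail {B c : ℕ} {d : ℕ → ℕ} (h : d 0 < B) :
    (∑ x ∈ Finset.range (c + 1), d x * B ^ x) / B = ∑ x ∈ Finset.range c, d (x + 1) * B ^ x := by
  have hB : 0 < B := by omega
  rw [Finset.sum_range_succ', pow_zero, mul_one]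
  have : ∑ x ∈ Finset.range c, d (x + 1) * B ^ (x + 1)
      = B * ∑ x ∈ Finset.range c, d (x + 1) * B ^ x := by
    rw [Finset.mul_sum]
    exact Finset.sum_congr rfl fun x _ => by ring
  rw [this, Nat.mul_add_div hB, Nat.div_eq_of_lt h, add_zero]

theorem packed_comb (B c u m : ℕ) (d e : ℕ → ℕ) :
    u * (∑ x ∈ Finset.range c, d x * B ^ x) + m * (∑ x ∈ Finset.range c, e x * B ^ x)
      = ∑ x ∈ Finset.range c, (u * d x + m * e x) * B ^ x := by
  rw [Finset.mul_sum, Finset.mul_sum, ← Finset.sum_add_distrib]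
  exact Finset.sum_congr rfl fun x _ => by ring

theorem packedRank_le_finrank (p : ℕ) [Fact p.Prime] (B c M : ℕ) (hM : M * (2 * p) ^ c ≤ B)
    (rows : List ℕ) (S : Submodule (ZMod p) (Fin c → ZMod p))
    (hrows : ∀ r ∈ rows, ∃ d : ℕ → ℕ, (∀ x, d x < M) ∧
      r = ∑ x ∈ Finset.range c, d x * B ^ x ∧ (fun x : Fin c => (d x : ZMod p)) ∈ S) :
    packedRank p B c rows ≤ Module.finrank (ZMod p) S := by
  have hp : 0 < p := (Fact.out : p.Prime).pos
  induction c generalizing M rows with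
  | zero => simp [packedRank]
  | succ c ih =>
    have hMB : M ≤ B := le_trans (Nat.le_mul_of_pos_right _ (by positivity)) hM
    rw [packedRank]
    split
    · refine le_trans (ih M ?_ _ (S.map (dropHead _ c)) ?_) (Submodule.finrank_map_le _ _)
      · exact le_trans (Nat.mul_le_mul_left _ (Nat.pow_le_pow_right (by omega) (by omega))) hM
      · intro r hr
        rw [mapForce_eq] at hr
        obtain ⟨s, hs, rfl⟩ := List.mem_map.mp hr
        obtain ⟨d, hd, rfl, hS⟩ := hrows s hs
        exact ⟨fun x => d (x + 1), fun x => hd _, packed_tail ((hd 0).trans_le hMB),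
          ⟨_, hS, by ext x; simp [dropHead, LinearMap.funLeft]⟩⟩
    · rename_i r rest heq
      obtain ⟨hr, hpiv, hrest⟩ := extractPivot_spec heq
      rw [force_eq, mapForce_eq]
      obtain ⟨e, he, rfl, heS⟩ := hrows r hr
      have he0 : e 0 < B := (he 0).trans_le hMB
      rw [packed_head he0] at hpiv ⊢
      replace hpiv : e 0 % p ≠ 0 := by simpa using hpiv
      let T : Submodule (ZMod p) (Fin (c + 1) → ZMod p) :=
        S ⊓ LinearMap.ker (LinearMap.proj (R := ZMod p) (φ := fun _ : Fin (c + 1) => ZMod p) 0)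
      have hlt : T < S := by
        refine lt_of_le_of_ne inf_le_left fun h => hpiv ?_
        have h0 : (e 0 : ZMod p) = 0 := by exact_mod_cast (h ▸ heS : _ ∈ T).2
        exact Nat.mod_eq_zero_of_dvd ((ZMod.natCast_eq_zero_iff _ _).mp h0)
      refine Nat.succ_le_of_lt (lt_of_le_of_lt ?_ (Submodule.finrank_lt_finrank_of_lt hlt))
      refine le_trans (ih (M * (2 * p)) ?_ _ (T.map (dropHead _ c)) ?_)
        (Submodule.finrank_map_le _ _)
      · rwa [mul_assoc, ← pow_succ']
      · intro t ht
        obtain ⟨s, hs, rfl⟩ := List.mem_map.mp ht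
        obtain ⟨d, hd, rfl, hdS⟩ := hrows s (hrest s hs)
        have hd0 : d 0 < B := (hd 0).trans_le hMB
        dsimp only at *
        rw [packed_head hd0, packed_comb]
        have hbound : ∀ x, e 0 % p * d x + (p - d 0 % p) * e x < M * (2 * p) := fun x => by
          have h1 := Nat.mod_lt (e 0) hp
          have h2 : e 0 % p * d x ≤ p * d x := Nat.mul_le_mul_right _ h1.le
          have h3 : (p - d 0 % p) * e x ≤ p * e x := Nat.mul_le_mul_right _ (by omega)
          have h4 := Nat.mul_lt_mul_of_pos_left (hd x) hp
          have h5 := Nat.mul_lt_mul_of_pos_left (he x) hp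
          nlinarith
        have hB2 : M * (2 * p) ≤ B :=
          le_trans (Nat.mul_le_mul_left _ (Nat.le_self_pow (by omega) _)) hM
        have hcast : ∀ x, ((e 0 % p * d x + (p - d 0 % p) * e x : ℕ) : ZMod p)
            = (e 0 : ZMod p) * d x - d 0 * e x := fun x => by
          rw [Nat.cast_add, Nat.cast_mul, Nat.cast_mul, Nat.cast_sub (Nat.mod_lt _ hp).le]
          simp
          ring
        refine ⟨fun x => e 0 % p * d (x + 1) + (p - d 0 % p) * e (x + 1), fun x => hbound _,
          packed_tail ((hbound 0).trans_le hB2), ⟨(e 0 : ZMod p) • (fun x : Fin (c + 1) =>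
            (d x : ZMod p)) - (d 0 : ZMod p) • (fun x : Fin (c + 1) => (e x : ZMod p)),
            ⟨S.sub_mem (S.smul_mem _ hdS) (S.smul_mem _ heS), ?_⟩, ?_⟩⟩
        · simp [mul_comm]
        · ext x
          simp only [hcast]
          simp [dropHead, LinearMap.funLeft]

theorem Matrix.rank_map_zmod_le {m l : Type*} [Fintype m] [Fintype l] (p : ℕ) [Fact p.Prime]
    (K : Type*) [Field K] [CharZero K] (A : Matrix m l ℕ) :
    (A.map (Nat.cast : ℕ → ZMod p)).rank ≤ (A.map (Nat.cast : ℕ → K)).rank := by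
  classical
  obtain ⟨r, g, hr, hli⟩ : ∃ (r : ℕ) (g : Fin r → m),
      r = (A.map (Nat.cast : ℕ → ZMod p)).rank ∧
      LinearIndependent (ZMod p) fun i => (A.map (Nat.cast : ℕ → ZMod p)).row (g i) := by
    obtain ⟨f, hf, -, hli⟩ := Submodule.exists_fun_fin_finrank_span_eq (ZMod p)
      (Set.range (A.map (Nat.cast : ℕ → ZMod p)).row)
    choose g hg using hf
    refine ⟨_, g, (Matrix.rank_eq_finrank_span_row _).symm, ?_⟩
    rw [funext hg]
    exact hli
  let B : Matrix (Fin r) l ℕ := A.submatrix g id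
  have hrank : (B.map (Nat.cast : ℕ → ZMod p)).rank = r := by
    rw [LinearIndependent.rank_matrix (M := B.map (Nat.cast : ℕ → ZMod p)) hli, Fintype.card_fin]
  have hsurj : Function.Surjective (B.map (Nat.cast : ℕ → ZMod p)).mulVec := by
    have : LinearMap.range (B.map (Nat.cast : ℕ → ZMod p)).mulVecLin = ⊤ :=
      Submodule.eq_top_of_finrank_eq (by rw [Module.finrank_fin_fun]; exact hrank)
    exact LinearMap.range_eq_top.mp this
  obtain ⟨C, hC⟩ := Matrix.mulVec_surjective_iff_exists_right_inverse.mp hsurj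
  let C' : Matrix l (Fin r) ℤ := C.map (fun x => (x.val : ℤ))
  let B' : Matrix (Fin r) l ℤ := B.map Nat.cast
  have hdet : (B' * C').det ≠ 0 := fun h => by
    have h1 : (Int.castRingHom (ZMod p)) (B' * C').det = 1 := by
      rw [RingHom.map_det, RingHom.mapMatrix_apply, Matrix.map_mul]
      have e1 : B'.map (Int.castRingHom (ZMod p)) = B.map (Nat.cast : ℕ → ZMod p) := by
        ext; simp [B']
      have e2 : C'.map (Int.castRingHom (ZMod p)) = C := by
        ext; simp [C']
      rw [e1, e2, hC, Matrix.det_one]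
    rw [h, map_zero] at h1
    exact zero_ne_one h1
  have hdetK : (B'.map (Int.castRingHom K) * C'.map (Int.castRingHom K)).det ≠ 0 := by
    rw [← Matrix.map_mul, ← RingHom.mapMatrix_apply, ← RingHom.map_det]
    simpa using hdet
  have hunit : IsUnit (B'.map (Int.castRingHom K) * C'.map (Int.castRingHom K)) :=
    (Matrix.isUnit_iff_isUnit_det _).mpr hdetK.isUnit
  rw [← hr]
  calc r = (B'.map (Int.castRingHom K) * C'.map (Int.castRingHom K)).rank := by
        rw [Matrix.rank_of_isUnit _ hunit, Fintype.card_fin]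
    _ ≤ (B'.map (Int.castRingHom K)).rank := Matrix.rank_mul_le_left _ _
    _ = ((A.map (Nat.cast : ℕ → K)).submatrix g id).rank := by
        congr 1
        ext; simp [B', B]
    _ ≤ _ := Matrix.rank_submatrix_le _ _ _

/-- The multi-indices of the coordinates on the tensor space with format `n`. -/
abbrev Multiindex {k : ℕ} (n : Fin k → ℕ) : Type := ∀ i, Fin (n i + 1)

section

variable {K : Type*} [Field K] {k : ℕ} {n : Fin k → ℕ}

/-- The parametrization `(wᵢ)ᵢ ↦ Σᵢ p₁ ⊗ ⋯ ⊗ wᵢ ⊗ ⋯ ⊗ p_k` of the affine tangent space to the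
Segre variety, in coordinates. -/
def segreTangentMap (p : ∀ i, Fin (n i + 1) → K) :
    (∀ i, Fin (n i + 1) → K) →ₗ[K] (Multiindex n → K) where
  toFun w I := ∑ i, w i (I i) * ∏ l ∈ Finset.univ.erase i, p l (I l)
  map_add' v w := by ext I; simp [add_mul, Finset.sum_add_distrib]
  map_smul' c w := by ext I; simp [Finset.mul_sum, mul_assoc]

theorem segreTangentMap_apply (p w : ∀ i, Fin (n i + 1) → K) (I : Multiindex n) :
    segreTangentMap p w I = ∑ i, w i (I i) * ∏ l ∈ Finset.univ.erase i, p l (I l) := rfl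

theorem segreTangentMap_single (p : ∀ i, Fin (n i + 1) → K) (i : Fin k) (v : Fin (n i + 1) → K)
    (I : Multiindex n) :
    segreTangentMap p (Pi.single i v) I = v (I i) * ∏ l ∈ Finset.univ.erase i, p l (I l) := by
  rw [segreTangentMap_apply, Finset.sum_eq_single i]
  · simp
  · intro l _ hl
    simp [hl]
  · simp

/-- The coordinates with respect to the standard basis of the tensor space. -/
noncomputable def tensorCoord (K : Type*) [Field K] {k : ℕ} (n : Fin k → ℕ) :
    (PiTensorProduct K fun i => (Fin (n i + 1) → K)) ≃ₗ[K] (Multiindex n → K) :=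
  (Basis.piTensorProduct fun i => Pi.basisFun K (Fin (n i + 1))).equivFun

theorem tensorCoord_tprod (v : ∀ i, Fin (n i + 1) → K) (I : Multiindex n) :
    tensorCoord K n (PiTensorProduct.tprod K v) I = ∏ i, v i (I i) := by
  simp [tensorCoord]

theorem tensorCoord_update (p : ∀ i, Fin (n i + 1) → K) (i : Fin k) (v : Fin (n i + 1) → K) :
    tensorCoord K n (PiTensorProduct.tprod K (Function.update p i v))
      = segreTangentMap p (Pi.single i v) := by
  ext I
  rw [tensorCoord_tprod, segreTangentMap_single, ← Finset.mul_prod_erase _ _ (Finset.mem_univ i)]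
  congr 1
  · simp
  · refine Finset.prod_congr rfl fun l hl => ?_
    rw [Function.update_of_ne (Finset.ne_of_mem_erase hl)]

theorem map_segreTangent (p : ∀ i, Fin (n i + 1) → K) :
    (segreTangent K n p).map (tensorCoord K n).toLinearMap = LinearMap.range (segreTangentMap p) := by
  rw [segreTangent, Submodule.map_iSup]
  apply le_antisymm
  · refine iSup_le fun i => ?_
    rintro _ ⟨_, ⟨v, rfl⟩, rfl⟩
    exact ⟨Pi.single i v, (tensorCoord_update p i v).symm⟩
  · rintro _ ⟨w, rfl⟩
    rw [← Finset.univ_sum_single w, map_sum]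
    refine Submodule.sum_mem _ fun i _ => Submodule.mem_iSup_of_mem i ?_
    exact ⟨_, ⟨w i, rfl⟩, tensorCoord_update p i (w i)⟩

/-- The parametrization of the sum of the tangent spaces at the points `p j`. -/
def tangentSumMap {s : ℕ} (p : Fin s → ∀ i, Fin (n i + 1) → K) :
    (Fin s → ∀ i, Fin (n i + 1) → K) →ₗ[K] (Multiindex n → K) :=
  ∑ j, segreTangentMap (p j) ∘ₗ LinearMap.proj j

theorem tangentSumMap_apply {s : ℕ} (p w : Fin s → ∀ i, Fin (n i + 1) → K) :
    tangentSumMap p w = ∑ j, segreTangentMap (p j) (w j) := by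
  simp [tangentSumMap]

theorem tangentSumMap_single {s : ℕ} (p : Fin s → ∀ i, Fin (n i + 1) → K) (j : Fin s)
    (w : ∀ i, Fin (n i + 1) → K) :
    tangentSumMap p (Pi.single j w) = segreTangentMap (p j) w := by
  rw [tangentSumMap_apply, Finset.sum_eq_single j]
  · simp
  · intro l _ hl
    simp [hl]
  · simp

theorem iSup_range_segreTangentMap {s : ℕ} (p : Fin s → ∀ i, Fin (n i + 1) → K) :
    ⨆ j, LinearMap.range (segreTangentMap (p j)) = LinearMap.range (tangentSumMap p) := by
  apply le_antisymm
  · refine iSup_le fun j => ?_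
    rintro _ ⟨w, rfl⟩
    exact ⟨Pi.single j w, tangentSumMap_single p j w⟩
  · rintro _ ⟨w, rfl⟩
    rw [tangentSumMap_apply]
    exact Submodule.sum_mem _ fun j _ => Submodule.mem_iSup_of_mem j ⟨w j, rfl⟩

theorem finrank_segre_eq {s : ℕ} (p : Fin s → ∀ i, Fin (n i + 1) → K)
    (q : ∀ _ : Fin k, Fin 0 → ∀ j, Fin (n j + 1) → K) :
    Module.finrank K (((⨆ j, segreTangent K n (p j)) ⊔ (⨆ i, ⨆ l, segreG K n (q i l) i)) :
      Submodule K (⨂[K] i, (Fin (n i + 1) → K)))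
      = Module.finrank K (LinearMap.range (tangentSumMap p)) := by
  have h : (⨆ i, ⨆ l, segreG K n (q i l) i) = ⊥ := by simp
  rw [h, sup_bot_eq, ← iSup_range_segreTangentMap, ← LinearEquiv.finrank_map_eq (tensorCoord K n)]
  rw [Submodule.map_iSup, iSup_congr fun j => map_segreTangent (p j)]

/-- Extension by zero of vectors with one coordinate removed. -/
def extendPivot (piv : Multiindex n) :
    (∀ i, {a : Fin (n i + 1) // a ≠ piv i} → K) →ₗ[K] (∀ i, Fin (n i + 1) → K) where
  toFun u i a := if h : a ≠ piv i then u i ⟨a, h⟩ else 0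
  map_add' u v := by ext i a; by_cases h : a = piv i <;> simp [h]
  map_smul' c u := by ext i a; by_cases h : a = piv i <;> simp [h]

theorem extendPivot_pivot (piv : Multiindex n) (u : ∀ i, {a : Fin (n i + 1) // a ≠ piv i} → K)
    (i : Fin k) : extendPivot piv u i (piv i) = 0 := by
  simp [extendPivot]

theorem extendPivot_of_ne (piv : Multiindex n) (u : ∀ i, {a : Fin (n i + 1) // a ≠ piv i} → K)
    (i : Fin k) {a : Fin (n i + 1)} (h : a ≠ piv i) : extendPivot piv u i a = u i ⟨a, h⟩ := by
  simp [extendPivot, h]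

theorem segreTangentMap_smul (p : ∀ i, Fin (n i + 1) → K) (c : Fin k → K) :
    segreTangentMap p (fun i => c i • p i) = (∑ i, c i) • fun I => ∏ i, p i (I i) := by
  ext I
  rw [segreTangentMap_apply, Pi.smul_apply, smul_eq_mul, Finset.sum_mul]
  refine Finset.sum_congr rfl fun i _ => ?_
  rw [← Finset.mul_prod_erase _ _ (Finset.mem_univ i), Pi.smul_apply, smul_eq_mul, mul_assoc]

theorem finrank_range_segreTangentMap {p : ∀ i, Fin (n i + 1) → K} (hk : 0 < k)
    (hp : ∀ i, p i ≠ 0) :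
    Module.finrank K (LinearMap.range (segreTangentMap p)) = 1 + ∑ i, n i := by
  have hpiv : ∀ i, ∃ a, p i a ≠ 0 := fun i => Function.ne_iff.mp (hp i)
  choose piv hpiv using hpiv
  let P : Multiindex n → K := fun I => ∏ i, p i (I i)
  let Ψ : (K × ∀ i, {a : Fin (n i + 1) // a ≠ piv i} → K) →ₗ[K] (Multiindex n → K) :=
    (LinearMap.toSpanSingleton K _ P).coprod (segreTangentMap p ∘ₗ extendPivot piv)
  have hΨ : ∀ c u, Ψ (c, u) = c • P + segreTangentMap p (extendPivot piv u) := fun c u => by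
    simp [Ψ]
  have hinj : Function.Injective Ψ := by
    rw [← LinearMap.ker_eq_bot, LinearMap.ker_eq_bot']
    rintro ⟨c, u⟩ h
    rw [hΨ] at h
    have hc : c = 0 := by
      have h1 := congrFun h piv
      simpa [segreTangentMap_apply, extendPivot_pivot, P, Finset.prod_eq_zero_iff, hpiv] using h1
    subst hc
    refine Prod.ext rfl ?_
    ext i ⟨a, ha⟩
    have h1 := congrFun h (Function.update piv i a)
    rw [zero_smul, zero_add, segreTangentMap_apply, Finset.sum_eq_single i] at h1
    · rw [Function.update_self, extendPivot_of_ne _ _ _ ha] at h1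
      refine (mul_eq_zero.mp h1).resolve_right (Finset.prod_ne_zero_iff.mpr fun l hl => ?_)
      rw [Function.update_of_ne (Finset.ne_of_mem_erase hl)]
      exact hpiv l
    · intro l _ hl
      rw [Function.update_of_ne hl, extendPivot_pivot, zero_mul]
    · simp
  have hrange : LinearMap.range Ψ = LinearMap.range (segreTangentMap p) := by
    apply le_antisymm
    · rintro _ ⟨⟨c, u⟩, rfl⟩
      rw [hΨ]
      refine Submodule.add_mem _ (Submodule.smul_mem _ _ ⟨Pi.single ⟨0, hk⟩ (p _), ?_⟩) ⟨_, rfl⟩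
      ext I
      rw [segreTangentMap_single, Finset.mul_prod_erase _ (fun l => p l (I l)) (Finset.mem_univ _)]
    · rintro _ ⟨w, rfl⟩
      let c : Fin k → K := fun i => w i (piv i) / p i (piv i)
      refine ⟨(∑ i, c i, fun i a => w i a - c i * p i a), ?_⟩
      rw [hΨ, ← segreTangentMap_smul, ← map_add]
      congr 1
      ext i a
      by_cases h : a = piv i
      · subst h
        simp [extendPivot_pivot, c, div_mul_cancel₀ _ (hpiv i)]
      · simp [extendPivot_of_ne _ _ _ h]
  rw [← hrange, LinearMap.finrank_range_of_inj hinj, Module.finrank_prod, Module.finrank_self,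
    Module.finrank_pi_fintype]
  simp

end

section

variable {K : Type*} [Field K] {k : ℕ} {n : Fin k → ℕ} {s : ℕ}

/-- The tangent spaces at the points `p j` are linearly independent subspaces. -/
def TangentIndep (p : Fin s → ∀ i, Fin (n i + 1) → K) : Prop :=
  ∀ w, tangentSumMap p w = 0 → ∀ j, segreTangentMap (p j) (w j) = 0

/-- The tangent spaces at the points `p j` span the tensor space. -/
def TangentSpan (p : Fin s → ∀ i, Fin (n i + 1) → K) : Prop :=
  Function.Surjective (tangentSumMap p)

/-- The map from the external direct sum of the tangent spaces. -/
def tangentCoprod (p : Fin s → ∀ i, Fin (n i + 1) → K) :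
    (∀ j, LinearMap.range (segreTangentMap (p j))) →ₗ[K] (Multiindex n → K) :=
  ∑ j, (LinearMap.range (segreTangentMap (p j))).subtype ∘ₗ LinearMap.proj j

theorem tangentCoprod_apply (p : Fin s → ∀ i, Fin (n i + 1) → K)
    (t : ∀ j, LinearMap.range (segreTangentMap (p j))) :
    tangentCoprod p t = ∑ j, (t j : Multiindex n → K) := by
  simp [tangentCoprod]

theorem range_tangentCoprod (p : Fin s → ∀ i, Fin (n i + 1) → K) :
    LinearMap.range (tangentCoprod p) = LinearMap.range (tangentSumMap p) := by
  apply le_antisymm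
  · rintro _ ⟨t, rfl⟩
    choose w hw using fun j => (t j).2
    exact ⟨w, by simp_rw [tangentSumMap_apply, tangentCoprod_apply, hw]⟩
  · rintro _ ⟨w, rfl⟩
    exact ⟨fun j => ⟨_, w j, rfl⟩, by rw [tangentSumMap_apply, tangentCoprod_apply]⟩

theorem tangentIndep_iff_injective (p : Fin s → ∀ i, Fin (n i + 1) → K) :
    TangentIndep p ↔ Function.Injective (tangentCoprod p) := by
  rw [← LinearMap.ker_eq_bot, LinearMap.ker_eq_bot']
  constructor
  · intro h t ht
    choose w hw using fun j => (t j).2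
    ext1 j
    rw [tangentCoprod_apply] at ht
    rw [← Subtype.coe_inj, ← hw]
    exact h w (by rw [tangentSumMap_apply, ← ht]; exact Finset.sum_congr rfl fun j _ => hw j) j
  · intro h w hw j
    rw [tangentSumMap_apply] at hw
    have := h (fun j => ⟨_, w j, rfl⟩) (by rw [tangentCoprod_apply]; exact hw)
    exact congrArg Subtype.val (congrFun this j)

theorem finrank_tangent_pi {p : Fin s → ∀ i, Fin (n i + 1) → K} (hk : 0 < k)
    (hp : ∀ j i, p j i ≠ 0) :
    Module.finrank K (∀ j, LinearMap.range (segreTangentMap (p j))) = s * (1 + ∑ i, n i) := by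
  rw [Module.finrank_pi_fintype]
  simp [finrank_range_segreTangentMap hk (hp _)]

theorem finrank_tangentSum_le {p : Fin s → ∀ i, Fin (n i + 1) → K} (hk : 0 < k)
    (hp : ∀ j i, p j i ≠ 0) :
    Module.finrank K (LinearMap.range (tangentSumMap p)) ≤ s * (1 + ∑ i, n i) := by
  rw [← finrank_tangent_pi hk hp, ← range_tangentCoprod]
  exact LinearMap.finrank_range_le _

theorem tangentIndep_iff_finrank {p : Fin s → ∀ i, Fin (n i + 1) → K} (hk : 0 < k)
    (hp : ∀ j i, p j i ≠ 0) :
    TangentIndep p ↔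
      Module.finrank K (LinearMap.range (tangentSumMap p)) = s * (1 + ∑ i, n i) := by
  rw [tangentIndep_iff_injective, ← finrank_tangent_pi hk hp, ← range_tangentCoprod]
  refine ⟨LinearMap.finrank_range_of_inj, fun h => ?_⟩
  have := LinearMap.finrank_range_add_finrank_ker (tangentCoprod p)
  rw [← LinearMap.ker_eq_bot, ← Submodule.finrank_eq_zero (R := K)]
  omega

theorem finrank_multiindex : Module.finrank K (Multiindex n → K) = ∏ i, (n i + 1) := by
  simp

theorem tangentSpan_iff_finrank {p : Fin s → ∀ i, Fin (n i + 1) → K} :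
    TangentSpan p ↔
      Module.finrank K (LinearMap.range (tangentSumMap p)) = ∏ i, (n i + 1) := by
  rw [TangentSpan, ← LinearMap.range_eq_top, ← finrank_multiindex (K := K)]
  exact ⟨fun h => by rw [h, finrank_top], Submodule.eq_top_of_finrank_eq⟩

theorem THolds.of_finrank {p : Fin s → ∀ i, Fin (n i + 1) → K} (hp : ∀ j i, p j i ≠ 0)
    (h : Module.finrank K (LinearMap.range (tangentSumMap p))
      = min (s * (1 + ∑ i, n i)) (∏ i, (n i + 1))) : THolds K n s (fun _ => 0) :=
  ⟨p, fun _ l => l.elim0, hp, fun _ l => l.elim0, by rw [finrank_segre_eq, h]; simp⟩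

theorem TangentIndep.tHolds {p : Fin s → ∀ i, Fin (n i + 1) → K} (h : TangentIndep p)
    (hk : 0 < k) (hp : ∀ j i, p j i ≠ 0) : THolds K n s (fun _ => 0) := by
  rw [tangentIndep_iff_finrank hk hp] at h
  refine THolds.of_finrank hp ?_
  rw [h, eq_comm, min_eq_left_iff, ← h, ← finrank_multiindex (K := K)]
  exact Submodule.finrank_le _

/-- Replacing vanishing vectors by arbitrary ones keeps the tangent spaces spanning. -/
theorem TangentSpan.tHolds {p : Fin s → ∀ i, Fin (n i + 1) → K} (h : TangentSpan p)
    (hk : 0 < k) : THolds K n s (fun _ => 0) := by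
  classical
  let p' : Fin s → ∀ i, Fin (n i + 1) → K := fun j i => if p j i = 0 then 1 else p j i
  have hp' : ∀ j i, p' j i ≠ 0 := fun j i => by
    simp only [p']
    split_ifs with h0
    · exact one_ne_zero
    · exact h0
  have hspan : TangentSpan p' := by
    rw [TangentSpan, ← LinearMap.range_eq_top, eq_top_iff, ← LinearMap.range_eq_top.mpr h]
    rw [← iSup_range_segreTangentMap, ← iSup_range_segreTangentMap]
    refine iSup_mono fun j => ?_
    rintro _ ⟨w, rfl⟩
    rw [← Finset.univ_sum_single w, map_sum]
    refine Submodule.sum_mem _ fun i _ => ?_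
    by_cases h0 : ∃ l ≠ i, p j l = 0
    · obtain ⟨l, hl, h0⟩ := h0
      convert Submodule.zero_mem _
      ext I
      rw [segreTangentMap_single, Finset.prod_eq_zero (i := l) (by simp [hl]) (by simp [h0])]
      simp
    · push Not at h0
      refine ⟨Pi.single i (w i), ?_⟩
      ext I
      rw [segreTangentMap_single, segreTangentMap_single]
      congr 1
      refine Finset.prod_congr rfl fun l hl => ?_
      simp [p', h0 l (Finset.ne_of_mem_erase hl)]
  rw [tangentSpan_iff_finrank] at hspan
  refine THolds.of_finrank hp' ?_
  rw [hspan, eq_comm, min_eq_right_iff, ← hspan]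
  exact finrank_tangentSum_le hk hp'

/-- Restriction of the points to subspaces spanned by coordinates. -/
theorem TangentSpan.restrict {m : Fin k → ℕ} {p : Fin s → ∀ i, Fin (n i + 1) → K}
    (h : TangentSpan p) (hm : m ≤ n) :
    TangentSpan (n := m) fun j i a => p j i (a.castLE (Nat.succ_le_succ (hm i))) := by
  intro f
  let e : Multiindex m → Multiindex n := fun I i => (I i).castLE (Nat.succ_le_succ (hm i))
  have he : Function.Injective e := fun I J h => by
    ext i
    simpa [e] using congrArg Fin.val (congrFun h i)
  obtain ⟨w, hw⟩ := h (Function.extend e f 0)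
  refine ⟨fun j i a => w j i (a.castLE (Nat.succ_le_succ (hm i))), ?_⟩
  ext I
  rw [← he.extend_apply f 0 I, ← hw, tangentSumMap_apply, tangentSumMap_apply,
    Finset.sum_apply, Finset.sum_apply]
  rfl

/-- Extension of a vector by zero. -/
def padVec {a b : ℕ} (v : Fin (a + 1) → K) : Fin (b + 1) → K :=
  fun x => if h : x.1 < a + 1 then v ⟨x, h⟩ else 0

theorem padVec_castLE {a b : ℕ} (h : a + 1 ≤ b + 1) (v : Fin (a + 1) → K) (x : Fin (a + 1)) :
    padVec (b := b) v (x.castLE h) = v x :=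
  dif_pos x.2

theorem padVec_ne_zero {a b : ℕ} (h : a + 1 ≤ b + 1) {v : Fin (a + 1) → K} (hv : v ≠ 0) :
    padVec (b := b) v ≠ 0 := by
  obtain ⟨x, hx⟩ := Function.ne_iff.mp hv
  exact Function.ne_iff.mpr ⟨x.castLE h, by rwa [padVec_castLE]⟩

/-- The pure tensors obtained from points with independent tangent spaces by omitting one factor
are independent. -/
theorem TangentIndep.drop_factor {p : Fin s → ∀ i, Fin (n i + 1) → K} (h : TangentIndep p)
    (hp : ∀ j i, p j i ≠ 0) (i : Fin k) (c : Fin s → K)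
    (hc : ∀ I : Multiindex n, ∑ j, c j * ∏ l ∈ Finset.univ.erase i, p j l (I l) = 0) : c = 0 := by
  have key := h (fun j => Pi.single i fun _ => c j) (by
    ext I
    rw [tangentSumMap_apply, Finset.sum_apply, Pi.zero_apply, ← hc I]
    exact Finset.sum_congr rfl fun j _ => segreTangentMap_single _ _ _ _)
  ext j
  choose piv hpiv using fun l => Function.ne_iff.mp (hp j l)
  have := congrFun (key j) piv
  rw [segreTangentMap_single] at this
  exact (mul_eq_zero.mp this).resolve_right (Finset.prod_ne_zero_iff.mpr fun l _ => hpiv l)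

theorem TangentIndep.pad {m : Fin k → ℕ} {p : Fin s → ∀ i, Fin (n i + 1) → K}
    (h : TangentIndep p) (hp : ∀ j i, p j i ≠ 0) (hm : n ≤ m) :
    TangentIndep (n := m) fun j i => padVec (p j i) := by
  intro w hw
  have hcast : ∀ i, n i + 1 ≤ m i + 1 := fun i => Nat.succ_le_succ (hm i)
  let e : Multiindex n → Multiindex m := fun I i => (I i).castLE (hcast i)
  have hsmall := h (fun j i a => w j i (a.castLE (hcast i))) (by
    ext I
    have := congrFun hw (e I)
    rw [tangentSumMap_apply, Finset.sum_apply, Pi.zero_apply] at this ⊢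
    simpa only [segreTangentMap_apply, e, padVec_castLE] using this)
  have hbig : ∀ i (a : Fin (m i + 1)), n i + 1 ≤ a.1 → ∀ j, w j i a = 0 := by
    intro i a ha
    refine congrFun (h.drop_factor hp i (fun j => w j i a) fun I => ?_)
    have := congrFun hw (Function.update (e I) i a)
    rw [tangentSumMap_apply, Finset.sum_apply] at this
    rw [← Pi.zero_apply (M := fun _ => K) (Function.update (e I) i a), ← this]
    refine Finset.sum_congr rfl fun j _ => ?_
    rw [segreTangentMap_apply, Finset.sum_eq_single i]
    · rw [Function.update_self]
      congr 1
      refine Finset.prod_congr rfl fun l hl => ?_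
      rw [Function.update_of_ne (Finset.ne_of_mem_erase hl), padVec_castLE]
    · intro l _ hl
      rw [Finset.prod_eq_zero (i := i) (by simp [hl.symm]), mul_zero]
      simp [padVec, Nat.not_lt.mpr ha]
    · simp
  intro j
  ext I
  by_cases hI : ∀ i, (I i).1 < n i + 1
  · have : I = e fun i => ⟨I i, hI i⟩ := rfl
    have h0 := congrFun (hsmall j) fun i => ⟨I i, hI i⟩
    rw [this, Pi.zero_apply]
    rw [Pi.zero_apply] at h0
    simpa only [segreTangentMap_apply, e, padVec_castLE] using h0
  · push Not at hI
    obtain ⟨i, hi⟩ := hI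
    rw [segreTangentMap_apply, Pi.zero_apply]
    refine Finset.sum_eq_zero fun l _ => ?_
    by_cases hl : l = i
    · subst hl
      rw [hbig l _ hi, zero_mul]
    · rw [Finset.prod_eq_zero (i := i) (by simp [Ne.symm hl]), mul_zero]
      simp [padVec, Nat.not_lt.mpr hi]

end

theorem Fin.prod_univ_erase_castSucc {M : Type*} [CommMonoid M] {k : ℕ} (f : Fin (k + 1) → M)
    (i : Fin k) : ∏ l ∈ Finset.univ.erase i.castSucc, f l
      = (∏ l ∈ Finset.univ.erase i, f l.castSucc) * f (Fin.last k) := by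
  simp only [← Finset.filter_ne', Finset.prod_filter, Fin.prod_univ_castSucc]
  simp [(Fin.castSucc_ne_last _).symm]

theorem Fin.prod_univ_erase_last {M : Type*} [CommMonoid M] {k : ℕ} (f : Fin (k + 1) → M) :
    ∏ l ∈ Finset.univ.erase (Fin.last k), f l = ∏ l : Fin k, f l.castSucc := by
  simp only [← Finset.filter_ne', Finset.prod_filter, Fin.prod_univ_castSucc]
  simp [Fin.castSucc_ne_last]

section

variable {K : Type*} [Field K] {k s : ℕ}

theorem segreTangentMap_succ {n : Fin (k + 1) → ℕ} (p w : ∀ i, Fin (n i + 1) → K)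
    (I : Multiindex n) :
    segreTangentMap p w I =
      p (Fin.last k) (I (Fin.last k)) * segreTangentMap (n := fun i : Fin k => n i.castSucc)
        (fun i => p i.castSucc) (fun i => w i.castSucc) (fun i => I i.castSucc)
      + w (Fin.last k) (I (Fin.last k)) * ∏ l : Fin k, p l.castSucc (I l.castSucc) := by
  rw [segreTangentMap_apply, Fin.sum_univ_castSucc, Fin.prod_univ_erase_last,
    segreTangentMap_apply, Finset.mul_sum]
  congr 1
  refine Finset.sum_congr rfl fun i _ => ?_
  rw [Fin.prod_univ_erase_castSucc]
  ring

theorem TangentIndep.of_castSucc {n : Fin (k + 1) → ℕ} {p : Fin s → ∀ i, Fin (n i + 1) → K}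
    (hk : 0 < k)
    (h : TangentIndep (n := fun i : Fin k => n i.castSucc) fun j i => p j i.castSucc) :
    TangentIndep p := by
  intro w hw
  let W : Fin (n (Fin.last k) + 1) → Fin s → ∀ i : Fin k, Fin (n i.castSucc + 1) → K :=
    fun a j => p j (Fin.last k) a • (fun i : Fin k => w j i.castSucc)
      + Pi.single ⟨0, hk⟩ (w j (Fin.last k) a • p j (Fin.castSucc ⟨0, hk⟩))
  have hW : ∀ j I, segreTangentMap (p j) (w j) I =
      segreTangentMap (n := fun i : Fin k => n i.castSucc) (fun i => p j i.castSucc)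
        (W (I (Fin.last k)) j) (fun i => I i.castSucc) := by
    intro j I
    rw [segreTangentMap_succ, map_add, map_smul, Pi.add_apply, Pi.smul_apply, smul_eq_mul,
      segreTangentMap_single, Pi.smul_apply, smul_eq_mul, mul_assoc,
      Finset.mul_prod_erase _ (fun l : Fin k => p j l.castSucc (I l.castSucc)) (Finset.mem_univ _)]
  have hsum : ∀ a, tangentSumMap (n := fun i : Fin k => n i.castSucc)
      (fun j i => p j i.castSucc) (W a) = 0 := by
    intro a
    ext I
    have h1 := congrFun hw (Fin.snoc (α := fun i => Fin (n i + 1)) I a)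
    rw [tangentSumMap_apply, Finset.sum_apply, Pi.zero_apply] at h1 ⊢
    rw [← h1]
    refine Finset.sum_congr rfl fun j _ => ?_
    rw [hW]
    simp
  intro j
  ext I
  rw [hW, h _ (hsum _) j]
  rfl

/-- There are `s` points of the Segre variety of format `n` with independent tangent spaces. -/
def HasTangentIndep (K : Type*) [Field K] {k : ℕ} (n : Fin k → ℕ) (s : ℕ) : Prop :=
  ∃ p : Fin s → ∀ i, Fin (n i + 1) → K, (∀ j i, p j i ≠ 0) ∧ TangentIndep p

/-- There are `s` points of the Segre variety of format `n` whose tangent spaces span. -/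
def HasTangentSpan (K : Type*) [Field K] {k : ℕ} (n : Fin k → ℕ) (s : ℕ) : Prop :=
  ∃ p : Fin s → ∀ i, Fin (n i + 1) → K, TangentSpan p

theorem HasTangentIndep.mono {m n : Fin k → ℕ} (h : HasTangentIndep K n s) (hm : n ≤ m) :
    HasTangentIndep K m s := by
  obtain ⟨p, hp, h⟩ := h
  exact ⟨_, fun j i => padVec_ne_zero (Nat.succ_le_succ (hm i)) (hp j i), h.pad hp hm⟩

theorem HasTangentSpan.anti {m n : Fin k → ℕ} (h : HasTangentSpan K n s) (hm : m ≤ n) :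
    HasTangentSpan K m s := by
  obtain ⟨p, h⟩ := h
  exact ⟨_, h.restrict hm⟩

theorem HasTangentIndep.of_castSucc {n : Fin (k + 1) → ℕ} (hk : 0 < k)
    (h : HasTangentIndep K (fun i : Fin k => n i.castSucc) s) : HasTangentIndep K n s := by
  obtain ⟨p, hp, h⟩ := h
  refine ⟨fun j => Fin.snoc (α := fun i => Fin (n i + 1) → K) (p j) 1, fun j i => ?_, ?_⟩
  · refine Fin.lastCases ?_ (fun i => ?_) i
    · dsimp only
      rw [Fin.snoc_last]
      exact one_ne_zero
    · dsimp only
      rw [Fin.snoc_castSucc]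
      exact hp j i
  · apply TangentIndep.of_castSucc hk
    simpa only [Fin.snoc_castSucc] using h

theorem HasTangentIndep.tHolds {n : Fin k → ℕ} (hk : 0 < k) (h : HasTangentIndep K n s) :
    THolds K n s (fun _ => 0) := by
  obtain ⟨p, hp, h⟩ := h
  exact h.tHolds hk hp

theorem HasTangentSpan.tHolds {n : Fin k → ℕ} (hk : 0 < k) (h : HasTangentSpan K n s) :
    THolds K n s (fun _ => 0) := by
  obtain ⟨p, h⟩ := h
  exact h.tHolds hk

/-- Independence of the tangent spaces for some number of factors `P¹` propagates to all formats
with at least as many factors. -/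
theorem HasTangentIndep.of_ones {k₀ : ℕ} (hk₀ : 0 < k₀)
    (h : HasTangentIndep K (fun _ : Fin k₀ => 1) s) (hk : k₀ ≤ k) (n : Fin k → ℕ)
    (hn : ∀ i, 1 ≤ n i) : HasTangentIndep K n s := by
  induction k, hk using Nat.le_induction with
  | base => exact h.mono hn
  | succ k hk ih => exact .of_castSucc (by omega) (ih _ fun i => hn _)

end

section

variable {K : Type*} [Field K] {m s : ℕ}

/-- Vectors orthogonal to `s` given ones. -/
theorem exists_linearIndependent_orthogonal {ι : Type*} [Fintype ι] {d : ℕ} (hd : Fintype.card ι = d)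
    (q : Fin s → ι → K) : ∃ b : Fin (d - s) → ι → K, LinearIndependent K b ∧ ∀ x j, b x ⬝ᵥ q j = 0 := by
  let L : (ι → K) →ₗ[K] (Fin s → K) := (Matrix.of q).mulVecLin
  have h1 := LinearMap.finrank_range_add_finrank_ker L
  have h2 := Submodule.finrank_le (LinearMap.range L)
  rw [Module.finrank_fintype_fun_eq_card] at h1
  rw [Module.finrank_fin_fun] at h2
  obtain ⟨b, hb⟩ := exists_linearIndependent_of_le_finrank (R := K) (M := LinearMap.ker L)
    (n := d - s) (by omega)
  refine ⟨fun x => b x, hb.map' (LinearMap.ker L).subtype (Submodule.ker_subtype _),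
    fun x j => ?_⟩
  rw [dotProduct_comm]
  exact congrFun (LinearMap.mem_ker.mp (b x).2) j

variable {n : Fin (m + 1) → ℕ}

theorem sum_multiindex_snoc (f : Multiindex n → K) :
    ∑ I, f I = ∑ t : Fin (n (Fin.last m) + 1), ∑ J : Multiindex fun i : Fin m => n i.castSucc,
      f (Fin.snoc (α := fun i => Fin (n i + 1)) J t) := by
  rw [← (Fin.snocEquiv fun i => Fin (n i + 1)).sum_comp, Fintype.sum_prod_type]
  rfl

theorem finrank_tangentSum_add_le (p : Fin s → ∀ i, Fin (n i + 1) → K) :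
    Module.finrank K (LinearMap.range (tangentSumMap p))
      + (∏ i : Fin m, (n i.castSucc + 1) - s) * (n (Fin.last m) + 1 - s)
      ≤ (∏ i : Fin m, (n i.castSucc + 1)) * (n (Fin.last m) + 1) := by
  obtain ⟨b, hb, hbq⟩ := exists_linearIndependent_orthogonal
    (ι := Multiindex fun i : Fin m => n i.castSucc) (d := ∏ i : Fin m, (n i.castSucc + 1))
    (by simp)
    (fun (j : Fin s) J => ∏ l : Fin m, p j l.castSucc (J l))
  obtain ⟨c, hc, hcq⟩ := exists_linearIndependent_orthogonal
    (Fintype.card_fin (n (Fin.last m) + 1)) fun j : Fin s => p j (Fin.last m)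
  let M : Matrix (Fin (∏ i : Fin m, (n i.castSucc + 1) - s) × Fin (n (Fin.last m) + 1 - s))
      (Multiindex n) K :=
    .of fun x I => b x.1 (fun i => I i.castSucc) * c x.2 (I (Fin.last m))
  have hM : LinearIndependent K M.row := by
    rw [Fintype.linearIndependent_iff] at hb hc ⊢
    intro g hg x
    refine hc (fun y => g (x.1, y)) ?_ x.2
    ext t
    rw [Finset.sum_apply, Pi.zero_apply]
    refine hb (fun x => ∑ y, (g (x, y) • c y) t) ?_ x.1
    ext J
    have h1 := congrFun hg (Fin.snoc (α := fun i => Fin (n i + 1)) J t)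
    rw [Finset.sum_apply, Pi.zero_apply, Fintype.sum_prod_type] at h1
    rw [Finset.sum_apply, Pi.zero_apply, ← h1]
    refine Finset.sum_congr rfl fun x _ => ?_
    rw [Pi.smul_apply, smul_eq_mul, Finset.sum_mul]
    refine Finset.sum_congr rfl fun y _ => ?_
    simp [M, Matrix.row]
    ring
  have hker : LinearMap.range (tangentSumMap p) ≤ LinearMap.ker M.mulVecLin := by
    rw [← iSup_range_segreTangentMap]
    refine iSup_le fun j => ?_
    rintro _ ⟨w, rfl⟩
    rw [LinearMap.mem_ker]
    ext ⟨x, y⟩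
    have h1 : ∑ t, c y t * p j (Fin.last m) t = 0 := hcq y j
    have h2 : ∑ J, b x J * ∏ l : Fin m, p j l.castSucc (J l) = 0 := hbq x j
    simp only [Matrix.mulVecLin_apply, Matrix.mulVec, dotProduct, M, Matrix.of_apply,
      sum_multiindex_snoc, segreTangentMap_succ, Fin.snoc_castSucc, Fin.snoc_last, mul_add,
      Finset.sum_add_distrib, Pi.zero_apply]
    have e1 : ∀ t J, b x J * c y t * (p j (Fin.last m) t *
        segreTangentMap (n := fun i : Fin m => n i.castSucc) (fun i => p j i.castSucc)
          (fun i => w i.castSucc) J) = (c y t * p j (Fin.last m) t) * (b x J *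
        segreTangentMap (n := fun i : Fin m => n i.castSucc) (fun i => p j i.castSucc)
          (fun i => w i.castSucc) J) := fun t J => by ring
    have e2 : ∀ t J, b x J * c y t * (w (Fin.last m) t * ∏ l : Fin m, p j l.castSucc (J l))
        = (c y t * w (Fin.last m) t) * (b x J * ∏ l : Fin m, p j l.castSucc (J l)) :=
      fun t J => by ring
    simp_rw [e1, e2, ← Finset.mul_sum, h2, ← Finset.sum_mul, h1]
    simp
  have h1 := LinearMap.finrank_range_add_finrank_ker M.mulVecLin
  have h2 : Module.finrank K (LinearMap.range M.mulVecLin) = _ := LinearIndependent.rank_matrix hM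
  have h3 := Submodule.finrank_mono hker
  rw [Fintype.card_prod, Fintype.card_fin, Fintype.card_fin] at h2
  rw [finrank_multiindex, Fin.prod_univ_castSucc] at h1
  omega

theorem TFails.of_prod (hs : 0 < s) (hD : s < ∏ i : Fin m, (n i.castSucc + 1))
    (hd : ∏ i : Fin m, (n i.castSucc + 1) < s + ∑ i : Fin m, n i.castSucc)
    (ha : s ≤ n (Fin.last m)) : TFails K n s (fun _ => 0) := by
  intro p q _ _
  rw [finrank_segre_eq]
  have h := finrank_tangentSum_add_le p
  rw [Fin.sum_univ_castSucc, Fin.prod_univ_castSucc]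
  simp only [zero_mul, Finset.sum_const_zero, add_zero]
  generalize ∏ i : Fin m, (n i.castSucc + 1) = D at *
  generalize ∑ i : Fin m, n i.castSucc = d at *
  generalize n (Fin.last m) = a at *
  obtain ⟨x, rfl⟩ := Nat.exists_eq_add_of_lt hD
  obtain ⟨y, rfl⟩ := Nat.exists_eq_add_of_le ha
  rw [show s + x + 1 - s = x + 1 by omega, show s + y + 1 - s = y + 1 by omega] at h
  rw [lt_min_iff]
  constructor <;> nlinarith

end

/-- If there are at least as many points as coordinates on the product of all factors but the last
one, then coordinate points have spanning tangent spaces. -/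
theorem HasTangentSpan.of_prod_le {K : Type*} [Field K] {m s : ℕ} {n : Fin (m + 1) → ℕ}
    (h : ∏ i : Fin m, (n i.castSucc + 1) ≤ s) : HasTangentSpan K n s := by
  obtain ⟨e⟩ : Nonempty ((Multiindex fun i : Fin m => n i.castSucc) ↪ Fin s) :=
    Function.Embedding.nonempty_of_card_le (by simpa using h)
  let g : Fin s → Multiindex fun i : Fin m => n i.castSucc := Function.invFun e
  have hg : ∀ J, g (e J) = J := Function.leftInverse_invFun e.injective
  refine ⟨fun j => Fin.snoc (α := fun i => Fin (n i + 1) → K) (fun i => Pi.single (g j i) 1) 0,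
    fun f => ?_⟩
  refine ⟨fun j => Fin.snoc (α := fun i => Fin (n i + 1) → K) 0 fun t =>
    Function.extend e (fun J => f (Fin.snoc (α := fun i => Fin (n i + 1)) J t)) 0 j, ?_⟩
  ext I
  rw [tangentSumMap_apply, Finset.sum_apply, Finset.sum_eq_single (e fun i => I i.castSucc)]
  · rw [segreTangentMap_succ]
    simp only [Fin.snoc_last, Fin.snoc_castSucc, e.injective.extend_apply, hg]
    have hI : (Fin.snoc (α := fun i => Fin (n i + 1)) (fun i : Fin m => I i.castSucc)
        (I (Fin.last m)) : Multiindex n) = I := Fin.snoc_init_self I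
    rw [hI]
    simp
  · intro j _ hj
    rw [segreTangentMap_succ]
    simp only [Fin.snoc_last, Fin.snoc_castSucc]
    by_cases hr : ∃ J, e J = j
    · obtain ⟨J, rfl⟩ := hr
      have hne : J ≠ fun i : Fin m => I i.castSucc := fun h => hj (by rw [h])
      obtain ⟨i, hi⟩ := Function.ne_iff.mp hne
      rw [hg, Finset.prod_eq_zero (Finset.mem_univ i) (by simp [Ne.symm hi])]
      simp
    · rw [Function.extend_apply' _ _ _ hr]
      simp
  · simp

/-- The coordinates of some explicit points on Segre varieties: the coordinate `a` of the factor
`l` of the point `j`. -/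
def explicitPoint (j l a : ℕ) : ℕ := (j + 1) ^ (a * (a + l)) % 127

/-- The coordinates of the tangent vector at the explicit point `j` which is obtained by replacing
the factor `i` with the basis vector `a`; this function gives the coordinates of its factors. -/
def tangentFactor {k : ℕ} (j : ℕ) (i : Fin k) (a : ℕ) (l : Fin k) (b : ℕ) : ℕ :=
  if l = i then (if b = a then 1 else 0) else explicitPoint j l b

/-- The tangent vector with factors `tangentFactor j i a`, packed into a natural number. -/
def packedTangent (B : ℕ) {k : ℕ} (n : Fin k → ℕ) (j : ℕ) (i : Fin k) (a : ℕ) : ℕ :=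
  ∏ l : Fin k, ∑ b : Fin (n l + 1), tangentFactor j i a l b *
    B ^ (b * ∏ r : Fin l, (n (Fin.castLE l.is_lt.le r) + 1))

/-- Packed generators of the sum of the tangent spaces at the first `s` explicit points. -/
def packedTangents (B : ℕ) {k : ℕ} (n : Fin k → ℕ) (s : ℕ) : List ℕ :=
  mapForce id <| (List.range s).flatMap fun j => (List.finRange k).flatMap fun i =>
    (List.range (n i + 1)).map fun a => packedTangent B n j i a

/-- A certified lower bound for the dimension of the sum of the tangent spaces at the first `s`
explicit points. -/
def explicitRank {k : ℕ} (n : Fin k → ℕ) (s : ℕ) : ℕ :=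
  force (∏ i, (n i + 1)) fun N => force (254 ^ (N + k + 1)) fun B =>
    packedRank 127 B N (packedTangents B n s)

theorem prod_sum_packed (B : ℕ) {k : ℕ} (n : Fin k → ℕ) (f : Fin k → ℕ → ℕ) :
    ∏ l : Fin k, ∑ b : Fin (n l + 1), f l b *
      B ^ (b * ∏ r : Fin l, (n (Fin.castLE l.is_lt.le r) + 1))
      = ∑ x : Fin (∏ i, (n i + 1)), (∏ l, f l (finPiFinEquiv.symm x l)) * B ^ (x : ℕ) := by
  rw [Finset.prod_univ_sum, Fintype.piFinset_univ, ← finPiFinEquiv.sum_comp]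
  refine Finset.sum_congr rfl fun I _ => ?_
  rw [Finset.prod_mul_distrib, Finset.prod_pow_eq_pow_sum, finPiFinEquiv_apply,
    Equiv.symm_apply_apply]

instance : Fact (Nat.Prime 127) := ⟨by norm_num⟩

theorem tangentFactor_le {k : ℕ} (j : ℕ) (i : Fin k) (a : ℕ) (l : Fin k) (b : ℕ) :
    tangentFactor j i a l b ≤ 127 := by
  rw [tangentFactor, explicitPoint]
  split_ifs
  · omega
  · omega
  · exact (Nat.mod_lt _ (by omega)).le

section

variable {k : ℕ} (n : Fin k → ℕ) (s : ℕ)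

/-- The generators of the sum of the tangent spaces at the first `s` explicit points. -/
def explicitMatrix :
    Matrix (Fin s × Σ i : Fin k, Fin (n i + 1)) (Fin (∏ i, (n i + 1))) ℕ :=
  .of fun r x => ∏ l, tangentFactor r.1 r.2.1 r.2.2 l (finPiFinEquiv.symm x l)

theorem explicitRank_le_rank :
    explicitRank n s ≤ ((explicitMatrix n s).map (Nat.cast : ℕ → ZMod 127)).rank := by
  rw [explicitRank, force_eq, force_eq, Matrix.rank_eq_finrank_span_row]
  refine packedRank_le_finrank 127 _ _ (127 ^ k + 1) ?_ _ _ ?_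
  · calc (127 ^ k + 1) * (2 * 127) ^ (∏ i, (n i + 1))
        ≤ 254 ^ (k + 1) * 254 ^ (∏ i, (n i + 1)) := by
          refine Nat.mul_le_mul ?_ le_rfl
          have h1 : 127 ^ k ≤ 254 ^ k := Nat.pow_le_pow_left (by norm_num) k
          have h2 : 1 ≤ 254 ^ k := Nat.one_le_pow _ _ (by norm_num)
          rw [pow_succ]
          omega
      _ = _ := by rw [← pow_add]; congr 1; ring
  · intro r hr
    simp only [packedTangents, mapForce_eq, List.map_id, List.mem_flatMap, List.mem_map,
      List.mem_range, List.mem_finRange, true_and] at hr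
    obtain ⟨j, hj, i, a, ha, rfl⟩ := hr
    refine ⟨fun x => if h : x < ∏ i, (n i + 1) then
      (explicitMatrix n s).row (⟨j, hj⟩, ⟨i, ⟨a, ha⟩⟩) ⟨x, h⟩ else 0, fun x => ?_, ?_, ?_⟩
    · dsimp only
      split_ifs with h
      · refine Nat.lt_succ_of_le ?_
        calc _ ≤ ∏ _l : Fin k, 127 := Finset.prod_le_prod' fun l _ => tangentFactor_le ..
          _ = 127 ^ k := by simp
      · positivity
    · rw [packedTangent, prod_sum_packed, Finset.sum_range]
      exact Finset.sum_congr rfl fun x _ => by dsimp only; rw [dif_pos x.2]; rfl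
    · refine Submodule.subset_span ⟨(⟨j, hj⟩, ⟨i, ⟨a, ha⟩⟩), ?_⟩
      ext x
      simp [Matrix.row]

/-- The explicit points. -/
def explicitPoints (K : Type*) [Field K] : Fin s → ∀ i, Fin (n i + 1) → K :=
  fun j i a => (explicitPoint j i a : K)

theorem explicitPoints_ne_zero (K : Type*) [Field K] (j : Fin s) (i : Fin k) :
    explicitPoints n s K j i ≠ 0 :=
  Function.ne_iff.mpr ⟨0, by simp [explicitPoints, explicitPoint]⟩

theorem rank_explicitMatrix_le (K : Type*) [Field K] :
    ((explicitMatrix n s).map (Nat.cast : ℕ → K)).rank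
      ≤ Module.finrank K (LinearMap.range (tangentSumMap (explicitPoints n s K))) := by
  rw [Matrix.rank_eq_finrank_span_row]
  refine le_trans (Submodule.finrank_mono ?_)
    (Submodule.finrank_map_le (LinearMap.funLeft K K finPiFinEquiv.symm) _)
  rw [Submodule.span_le]
  rintro _ ⟨⟨j, i, a⟩, rfl⟩
  refine ⟨_, ⟨Pi.single j (Pi.single i (Pi.single a 1)), rfl⟩, ?_⟩
  ext x
  rw [tangentSumMap_single, LinearMap.funLeft_apply, segreTangentMap_single]
  simp only [explicitMatrix, Matrix.row, Matrix.map_apply, Matrix.of_apply, Nat.cast_prod]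
  rw [← Finset.mul_prod_erase _
    (fun l => (tangentFactor j i a l (finPiFinEquiv.symm x l) : K)) (Finset.mem_univ i)]
  congr 1
  · simp [tangentFactor, Pi.single_apply, Fin.ext_iff]
  · refine Finset.prod_congr rfl fun l hl => ?_
    simp [tangentFactor, Finset.ne_of_mem_erase hl, explicitPoints]

theorem explicitRank_le_finrank (K : Type*) [Field K] [CharZero K] :
    explicitRank n s
      ≤ Module.finrank K (LinearMap.range (tangentSumMap (explicitPoints n s K))) :=
  (explicitRank_le_rank n s).trans
    ((Matrix.rank_map_zmod_le 127 K _).trans (rank_explicitMatrix_le n s K))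

variable {n s} {K : Type*} [Field K] [CharZero K]

theorem HasTangentIndep.of_explicitRank (hk : 0 < k) (h : s * (1 + ∑ i, n i) ≤ explicitRank n s) :
    HasTangentIndep K n s :=
  ⟨_, explicitPoints_ne_zero n s K, (tangentIndep_iff_finrank hk (explicitPoints_ne_zero n s K)).mpr
    (le_antisymm (finrank_tangentSum_le hk (explicitPoints_ne_zero n s K))
      (h.trans (explicitRank_le_finrank n s K)))⟩

theorem HasTangentSpan.of_explicitRank (h : ∏ i, (n i + 1) ≤ explicitRank n s) :
    HasTangentSpan K n s :=
  ⟨_, tangentSpan_iff_finrank.mpr (le_antisymm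
    ((Submodule.finrank_le _).trans_eq finrank_multiindex)
      (h.trans (explicitRank_le_finrank n s K)))⟩

variable (K)

theorem hasTangentIndep_155 : HasTangentIndep K ![1, 5, 5] 6 :=
  .of_explicitRank (by norm_num) (by decide +kernel)

theorem hasTangentSpan_155 : HasTangentSpan K ![1, 5, 5] 6 :=
  .of_explicitRank (by decide +kernel)

theorem hasTangentSpan_225 : HasTangentSpan K ![2, 2, 5] 6 :=
  .of_explicitRank (by decide +kernel)

theorem hasTangentIndep_234 : HasTangentIndep K ![2, 3, 4] 6 :=
  .of_explicitRank (by norm_num) (by decide +kernel)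

theorem hasTangentSpan_234 : HasTangentSpan K ![2, 3, 4] 6 :=
  .of_explicitRank (by decide +kernel)

theorem hasTangentIndep_333 : HasTangentIndep K ![3, 3, 3] 6 :=
  .of_explicitRank (by norm_num) (by decide +kernel)

theorem hasTangentSpan_1115 : HasTangentSpan K ![1, 1, 1, 5] 6 :=
  .of_explicitRank (by decide +kernel)

theorem hasTangentIndep_1123 : HasTangentIndep K ![1, 1, 2, 3] 6 :=
  .of_explicitRank (by norm_num) (by decide +kernel)

theorem hasTangentSpan_1123 : HasTangentSpan K ![1, 1, 2, 3] 6 :=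
  .of_explicitRank (by decide +kernel)

theorem hasTangentIndep_1222 : HasTangentIndep K ![1, 2, 2, 2] 6 :=
  .of_explicitRank (by norm_num) (by decide +kernel)

theorem hasTangentSpan_11111 : HasTangentSpan K ![1, 1, 1, 1, 1] 6 :=
  .of_explicitRank (by decide +kernel)

theorem hasTangentIndep_11112 : HasTangentIndep K ![1, 1, 1, 1, 2] 6 :=
  .of_explicitRank (by norm_num) (by decide +kernel)

theorem hasTangentIndep_111111 : HasTangentIndep K (fun _ : Fin 6 => 1) 6 :=
  .of_explicitRank (by norm_num) (by decide +kernel)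

end

section

variable (K : Type*) [Field K] [CharZero K]

theorem tHolds_three_factors (n : Fin 3 → ℕ) (h0 : 1 ≤ n 0) (h01 : n 0 ≤ n 1) (h12 : n 1 ≤ n 2)
    (h : ¬ (n 0 = 1 ∧ n 1 = 3 ∧ 6 ≤ n 2 ∨ n 0 = 1 ∧ n 1 = 4 ∧ 6 ≤ n 2 ∨
      n 0 = 2 ∧ n 1 = 2 ∧ 6 ≤ n 2)) :
    THolds K n 6 (fun _ => 0) := by
  have hk : 0 < 3 := by norm_num
  have hle : ∀ a b c, n 0 ≤ a → n 1 ≤ b → n 2 ≤ c → n ≤ ![a, b, c] := by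
    intro a b c ha hb hc i
    fin_cases i <;> assumption
  have hge : ∀ a b c, a ≤ n 0 → b ≤ n 1 → c ≤ n 2 → ![a, b, c] ≤ n := by
    intro a b c ha hb hc i
    fin_cases i <;> assumption
  have hsmall : (n 0 + 1) * (n 1 + 1) ≤ 6 → THolds K n 6 (fun _ => 0) := fun h =>
    (HasTangentSpan.of_prod_le (m := 2) (by rwa [Fin.prod_univ_two])).tHolds hk
  obtain h1 | h1 | h1 : n 0 = 1 ∨ n 0 = 2 ∨ 3 ≤ n 0 := by omega
  · obtain h2 | h2 | h2 : n 1 ≤ 2 ∨ (n 1 ≤ 4 ∧ n 2 ≤ 5) ∨ 5 ≤ n 1 := by omega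
    · exact hsmall (by rw [h1]; omega)
    · exact ((hasTangentSpan_155 K).anti
        (hle 1 5 5 (by omega) (by omega) (by omega))).tHolds hk
    · exact ((hasTangentIndep_155 K).mono
        (hge 1 5 5 (by omega) (by omega) (by omega))).tHolds hk
  · obtain h2 | h2 | h2 : (n 1 = 2 ∧ n 2 ≤ 5) ∨ (n 1 = 3 ∧ n 2 = 3) ∨ (3 ≤ n 1 ∧ 4 ≤ n 2) := by
      omega
    · exact ((hasTangentSpan_225 K).anti
        (hle 2 2 5 (by omega) (by omega) (by omega))).tHolds hk
    · exact ((hasTangentSpan_234 K).anti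
        (hle 2 3 4 (by omega) (by omega) (by omega))).tHolds hk
    · exact ((hasTangentIndep_234 K).mono
        (hge 2 3 4 (by omega) (by omega) (by omega))).tHolds hk
  · exact ((hasTangentIndep_333 K).mono
      (hge 3 3 3 (by omega) (by omega) (by omega))).tHolds hk

theorem tHolds_four_factors (n : Fin 4 → ℕ) (h0 : 1 ≤ n 0) (h01 : n 0 ≤ n 1) (h12 : n 1 ≤ n 2)
    (h23 : n 2 ≤ n 3) (h : ¬ (n 0 = 1 ∧ n 1 = 1 ∧ n 2 = 1 ∧ 6 ≤ n 3)) :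
    THolds K n 6 (fun _ => 0) := by
  have hk : 0 < 4 := by norm_num
  have hle : ∀ a b c d, n 0 ≤ a → n 1 ≤ b → n 2 ≤ c → n 3 ≤ d → n ≤ ![a, b, c, d] := by
    intro a b c d ha hb hc hd i
    fin_cases i <;> assumption
  have hge : ∀ a b c d, a ≤ n 0 → b ≤ n 1 → c ≤ n 2 → d ≤ n 3 → ![a, b, c, d] ≤ n := by
    intro a b c d ha hb hc hd i
    fin_cases i <;> assumption
  obtain h1 | h1 | h1 | h1 : (n 2 = 1 ∧ n 3 ≤ 5) ∨ (n 1 = 1 ∧ n 2 = 2 ∧ n 3 = 2) ∨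
    (2 ≤ n 2 ∧ 3 ≤ n 3) ∨ 2 ≤ n 1 := by omega
  · exact ((hasTangentSpan_1115 K).anti
      (hle 1 1 1 5 (by omega) (by omega) (by omega) (by omega))).tHolds hk
  · exact ((hasTangentSpan_1123 K).anti
      (hle 1 1 2 3 (by omega) (by omega) (by omega) (by omega))).tHolds hk
  · exact ((hasTangentIndep_1123 K).mono
      (hge 1 1 2 3 (by omega) (by omega) (by omega) (by omega))).tHolds hk
  · exact ((hasTangentIndep_1222 K).mono
      (hge 1 2 2 2 (by omega) (by omega) (by omega) (by omega))).tHolds hk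

theorem tHolds_five_factors (n : Fin 5 → ℕ) (hn : ∀ i, 1 ≤ n i) (hmono : Monotone n) :
    THolds K n 6 (fun _ => 0) := by
  have hk : 0 < 5 := by norm_num
  have hlast : ∀ i, n i ≤ n 4 := fun i => hmono (Fin.le_last i)
  obtain h1 | h1 : n 4 ≤ 1 ∨ 2 ≤ n 4 := by omega
  · refine ((hasTangentSpan_11111 K).anti fun i => ?_).tHolds hk
    have hi := (hlast i).trans h1
    fin_cases i <;> exact hi
  · refine ((hasTangentIndep_11112 K).mono fun i => ?_).tHolds hk
    have hi := hn i
    fin_cases i <;> assumption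

end

theorem tFails_three_factors (K : Type*) [Field K] (n : Fin 3 → ℕ) (h : n 0 = 1 ∧ n 1 = 3 ∧ 6 ≤ n 2 ∨
    n 0 = 1 ∧ n 1 = 4 ∧ 6 ≤ n 2 ∨ n 0 = 2 ∧ n 1 = 2 ∧ 6 ≤ n 2) :
    TFails K n 6 (fun _ => 0) := by
  have hprod : ∏ i : Fin 2, (n i.castSucc + 1) = (n 0 + 1) * (n 1 + 1) := Fin.prod_univ_two _
  have hsum : ∑ i : Fin 2, n i.castSucc = n 0 + n 1 := Fin.sum_univ_two _
  refine TFails.of_prod (m := 2) (by norm_num) ?_ ?_ ?_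
  · rw [hprod]
    obtain ⟨h0, h1, -⟩ | ⟨h0, h1, -⟩ | ⟨h0, h1, -⟩ := h <;> simp [h0, h1]
  · rw [hprod, hsum]
    obtain ⟨h0, h1, -⟩ | ⟨h0, h1, -⟩ | ⟨h0, h1, -⟩ := h <;> simp [h0, h1]
  · change 6 ≤ n 2
    omega

theorem tFails_four_factors (K : Type*) [Field K] (n : Fin 4 → ℕ) (h0 : n 0 = 1) (h1 : n 1 = 1) (h2 : n 2 = 1)
    (h3 : 6 ≤ n 3) : TFails K n 6 (fun _ => 0) := by
  have hprod : ∏ i : Fin 3, (n i.castSucc + 1) = (n 0 + 1) * (n 1 + 1) * (n 2 + 1) :=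
    Fin.prod_univ_three _
  have hsum : ∑ i : Fin 3, n i.castSucc = n 0 + n 1 + n 2 := Fin.sum_univ_three _
  refine TFails.of_prod (m := 3) (by norm_num) ?_ ?_ h3
  · simp [hprod, h0, h1, h2]
  · simp [hprod, hsum, h0, h1, h2]

/-- classification of defective 6-secant varieties.  Let `k ≥ 3` and
`1 ≤ n₁ ≤ ⋯ ≤ n_k`.  Then `T(n; 6; 0,…,0)` holds unless `(n₁,…,n_k) = (1,3,a)` with
`a ≥ 6`, `(1,4,a)` with `a ≥ 6`, `(2,2,a)` with `a ≥ 6`, or `(1,1,1,a)` with `a ≥ 6`,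
and in these exceptional cases it fails. -/
theorem secant6_classification
    (K : Type*) [Field K] [CharZero K] {k : ℕ} (hk : 3 ≤ k)
    (n : Fin k → ℕ) (hmono : Monotone n) (hpos : ∀ i, 1 ≤ n i) :
    (¬ ((k = 3 ∧ n ⟨0, by omega⟩ = 1 ∧ n ⟨1, by omega⟩ = 3 ∧ 6 ≤ n ⟨2, by omega⟩) ∨
        (k = 3 ∧ n ⟨0, by omega⟩ = 1 ∧ n ⟨1, by omega⟩ = 4 ∧ 6 ≤ n ⟨2, by omega⟩) ∨
        (k = 3 ∧ n ⟨0, by omega⟩ = 2 ∧ n ⟨1, by omega⟩ = 2 ∧ 6 ≤ n ⟨2, by omega⟩) ∨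
        (k = 4 ∧ (∀ i : Fin k, (i : ℕ) < 3 → n i = 1) ∧ 6 ≤ n ⟨k - 1, by omega⟩)) →
      THolds K n 6 (fun _ => 0)) ∧
    (((k = 3 ∧ n ⟨0, by omega⟩ = 1 ∧ n ⟨1, by omega⟩ = 3 ∧ 6 ≤ n ⟨2, by omega⟩) ∨
        (k = 3 ∧ n ⟨0, by omega⟩ = 1 ∧ n ⟨1, by omega⟩ = 4 ∧ 6 ≤ n ⟨2, by omega⟩) ∨
        (k = 3 ∧ n ⟨0, by omega⟩ = 2 ∧ n ⟨1, by omega⟩ = 2 ∧ 6 ≤ n ⟨2, by omega⟩) ∨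
        (k = 4 ∧ (∀ i : Fin k, (i : ℕ) < 3 → n i = 1) ∧ 6 ≤ n ⟨k - 1, by omega⟩)) →
      TFails K n 6 (fun _ => 0)) := by
  constructor
  · intro h
    obtain rfl | rfl | rfl | hk6 : k = 3 ∨ k = 4 ∨ k = 5 ∨ 6 ≤ k := by omega
    · refine tHolds_three_factors K n (hpos 0) (hmono (by decide)) (hmono (by decide)) ?_
      rintro (h' | h' | h')
      · exact h (.inl ⟨rfl, h'⟩)
      · exact h (.inr (.inl ⟨rfl, h'⟩))
      · exact h (.inr (.inr (.inl ⟨rfl, h'⟩)))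
    · refine tHolds_four_factors K n (hpos 0) (hmono (by decide)) (hmono (by decide))
        (hmono (by decide)) ?_
      rintro ⟨h0, h1, h2, h3⟩
      refine h (.inr (.inr (.inr ⟨rfl, fun i hi => ?_, h3⟩)))
      fin_cases i
      · exact h0
      · exact h1
      · exact h2
      · exact absurd hi (by decide)
    · exact tHolds_five_factors K n hpos hmono
    · exact (HasTangentIndep.of_ones (by norm_num) (hasTangentIndep_111111 K) hk6 n hpos).tHolds
        (by omega)
  · rintro (⟨rfl, h⟩ | ⟨rfl, h⟩ | ⟨rfl, h⟩ | ⟨rfl, h, h3⟩)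
    · exact tFails_three_factors K n (.inl h)
    · exact tFails_three_factors K n (.inr (.inl h))
    · exact tFails_three_factors K n (.inr (.inr h))
    · exact tFails_four_factors K n (h 0 (by decide)) (h 1 (by decide)) (h 2 (by decide)) h3
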